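/- Suppose gcd(q₁,q₂) = 1. Then for every γ ∈ Γ₁(q₁q₂), S_{χ₁,χ₂}(γ) lies in ℤ[χ₁,χ₂]. -/

import Mathlib

open Complex Finset
open scoped Classical

/-- The sawtooth function `B₁(x)`: `0` if `x ∈ ℤ`, and `x - ⌊x⌋ - 1/2` otherwise. -/
noncomputable def sawtooth (x : ℝ) : ℝ :=
  if ∃ n : ℤ, (n : ℝ) = x then 0 else Int.fract x - 1 / 2

/-- The newform Dedekind sum `S_{χ₁,χ₂}(a, c)` associated to Dirichlet characters
`χ₁ mod q₁` and `χ₂ mod q₂`. -/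
noncomputable def newformDedekindSum {q₁ q₂ : ℕ} (χ₁ : DirichletCharacter ℂ q₁)
    (χ₂ : DirichletCharacter ℂ q₂) (a c : ℤ) : ℂ :=
  ∑ j ∈ Finset.range c.toNat, ∑ n ∈ Finset.range q₁,
    (starRingEnd ℂ) (χ₂ (j : ZMod q₂)) * (starRingEnd ℂ) (χ₁ (n : ZMod q₁)) *
      (sawtooth ((j : ℝ) / (c : ℝ)) : ℂ) *
      (sawtooth ((n : ℝ) / (q₁ : ℝ) + (a : ℝ) * (j : ℝ) / (c : ℝ)) : ℂ)

/-- The newform Dedekind sum of a matrix `γ = (a, b; c, d) ∈ SL₂(ℤ)`: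
it is `S_{χ₁,χ₂}(a, c)` if `c ≥ 1`, `S_{χ₁,χ₂}(-γ)` if `c ≤ -1`, and `0` if `c = 0`. -/
noncomputable def newformDedekindSumSL {q₁ q₂ : ℕ} (χ₁ : DirichletCharacter ℂ q₁)
    (χ₂ : DirichletCharacter ℂ q₂) (γ : Matrix.SpecialLinearGroup (Fin 2) ℤ) : ℂ :=
  if γ.1 1 0 = 0 then 0
  else if 1 ≤ γ.1 1 0 then newformDedekindSum χ₁ χ₂ (γ.1 0 0) (γ.1 1 0)
  else newformDedekindSum χ₁ χ₂ (-(γ.1 0 0)) (-(γ.1 1 0))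

/-- Membership in `Γ₀(N)`: the lower-left entry is divisible by `N`. -/
def InGamma0 (N : ℕ) (γ : Matrix.SpecialLinearGroup (Fin 2) ℤ) : Prop :=
  (N : ℤ) ∣ γ.1 1 0

/-- Membership in `Γ₁(N)`: lower-left entry divisible by `N` and both diagonal
entries congruent to `1` mod `N`. -/
def InGamma1 (N : ℕ) (γ : Matrix.SpecialLinearGroup (Fin 2) ℤ) : Prop :=
  InGamma0 N γ ∧ (N : ℤ) ∣ (γ.1 0 0 - 1) ∧ (N : ℤ) ∣ (γ.1 1 1 - 1)

/-- `x` lies in the ring of integers `ℤ[χ₁,χ₂]` of the field `F_{χ₁,χ₂} ⊆ ℂ` generated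
by the values of `χ₁` and `χ₂`: `x` lies in the subfield of `ℂ` generated by the values
of the characters and is integral over `ℤ`. -/
def InRingOfIntegers {q₁ q₂ : ℕ} (χ₁ : DirichletCharacter ℂ q₁)
    (χ₂ : DirichletCharacter ℂ q₂) (x : ℂ) : Prop :=
  x ∈ Subfield.closure (Set.range (χ₁ : ZMod q₁ → ℂ) ∪ Set.range (χ₂ : ZMod q₂ → ℂ)) ∧
    IsIntegral ℤ x

theorem sawtooth_add_int (x : ℝ) (m : ℤ) : sawtooth (x + m) = sawtooth x := by
  have h : (∃ n : ℤ, (n : ℝ) = x + m) ↔ ∃ n : ℤ, (n : ℝ) = x :=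
    ⟨fun ⟨n, hn⟩ => ⟨n - m, by push_cast; linarith⟩,
      fun ⟨n, hn⟩ => ⟨n + m, by push_cast; linarith⟩⟩
  simp only [sawtooth, h, Int.fract_add_intCast]

theorem sawtooth_neg (x : ℝ) : sawtooth (-x) = -sawtooth x := by
  by_cases h : ∃ n : ℤ, (n : ℝ) = x
  · have h' : ∃ n : ℤ, (n : ℝ) = -x := h.imp' Neg.neg fun n hn => by simp [hn]
    simp [sawtooth, h, h']
  · have h' : ¬ ∃ n : ℤ, (n : ℝ) = -x := fun h' =>
      h (h'.imp' Neg.neg fun n hn => by simp [hn])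
    have hf : Int.fract x ≠ 0 := fun h0 => h ⟨⌊x⌋, by
      have := Int.floor_add_fract x
      linarith⟩
    simp only [sawtooth, h, h', if_false, Int.fract_neg hf]
    ring

theorem sawtooth_of_ne_int {x : ℝ} (h : ∀ n : ℤ, (n : ℝ) ≠ x) :
    sawtooth x = x - ⌊x⌋ - 1 / 2 := by
  rw [sawtooth, if_neg (not_exists.mpr h), Int.fract]

theorem sum_range_intCast_zmod {M : Type*} [AddCommMonoid M] {c : ℕ} [NeZero c] (f : ZMod c → M) :
    ∑ j ∈ range c, f ((j : ℤ) : ZMod c) = ∑ x, f x := by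
  refine Finset.sum_bij' (fun j _ => (j : ZMod c)) (fun x _ => x.val) (fun _ _ => mem_univ _)
    (fun x _ => mem_range.mpr x.val_lt)
    (fun j hj => ZMod.val_cast_of_lt (mem_range.mp hj)) (fun x _ => ZMod.natCast_zmod_val x)
    (fun j _ => by simp)

theorem Function.Periodic.exists_eq_zmod {M : Type*} {c : ℕ} [NeZero c]
    {F : ℤ → M} (hF : Function.Periodic F (c : ℤ)) :
    ∃ f : ZMod c → M, ∀ x : ℤ, F x = f x := by
  refine ⟨fun x => F x.val, fun x => ?_⟩
  beta_reduce
  rw [ZMod.val_intCast, Int.emod_def, mul_comm]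
  exact (hF.sub_int_mul_eq _).symm

theorem Function.Periodic.sum_range_add {M : Type*} [AddCommMonoid M] {c : ℕ} [NeZero c]
    {F : ℤ → M} (hF : Function.Periodic F (c : ℤ)) (m : ℤ) :
    ∑ j ∈ range c, F (j + m) = ∑ j ∈ range c, F j := by
  obtain ⟨f, hf⟩ := hF.exists_eq_zmod
  simp only [hf, Int.cast_add]
  rw [sum_range_intCast_zmod f, sum_range_intCast_zmod (fun x => f (x + (m : ZMod c)))]
  exact Equiv.sum_comp (Equiv.addRight (m : ZMod c)) f

theorem Function.Periodic.sum_range_mul {M : Type*} [AddCommMonoid M] {c : ℕ} [NeZero c]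
    {F : ℤ → M} (hF : Function.Periodic F (c : ℤ)) {u : ℤ} (hu : IsCoprime u c) :
    ∑ j ∈ range c, F (u * j) = ∑ j ∈ range c, F j := by
  obtain ⟨f, hf⟩ := hF.exists_eq_zmod
  simp only [hf, Int.cast_mul]
  rw [sum_range_intCast_zmod f, sum_range_intCast_zmod (fun x => f ((u : ZMod c) * x))]
  have hunit : IsUnit (u : ZMod c) := by
    obtain ⟨x, y, hxy⟩ := hu
    refine IsUnit.of_mul_eq_one (x : ZMod c) ?_
    have := congrArg (Int.cast : ℤ → ZMod c) hxy
    push_cast at this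
    simpa [mul_comm] using this
  obtain ⟨v, hv⟩ := hunit
  rw [← hv]
  exact Equiv.sum_comp (Units.mulLeft v) f

theorem sum_range_dirichletCharacter_eq_zero {q : ℕ} (hq : 0 < q) {χ : DirichletCharacter ℂ q}
    (hχ : χ ≠ 1) : ∑ n ∈ range q, χ (n : ZMod q) = 0 := by
  have : NeZero q := ⟨hq.ne'⟩
  rw [← MulChar.sum_eq_zero_of_ne_one hχ, ← sum_range_intCast_zmod]
  simp

/-- Summing over several periods of `χ` multiplies both moments by the number of periods. -/
theorem sum_range_mul_dirichletCharacter {q : ℕ} (hq : 0 < q) {χ : DirichletCharacter ℂ q}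
    (hχ : χ ≠ 1) (k : ℕ) :
    ∑ j ∈ range (q * k), χ (j : ZMod q) = 0 ∧
    ∑ j ∈ range (q * k), χ (j : ZMod q) * j = k * ∑ n ∈ range q, χ (n : ZMod q) * n := by
  have h0 := sum_range_dirichletCharacter_eq_zero hq hχ
  induction k with
  | zero => simp
  | succ k ih =>
    rw [mul_add_one, Finset.sum_range_add, Finset.sum_range_add, ih.1, ih.2]
    simp [mul_add, Finset.sum_add_distrib, ← Finset.sum_mul, h0, add_mul]

/-- The sum over `j` of a `1`-periodic function at `n / q₁ + a j / c`, weighted by `χ`, does not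
depend on `n`. -/
theorem sum_dirichletCharacter_mul_periodic {q₁ q₂ m : ℕ} (hc : 0 < q₁ * q₂ * m)
    (χ : DirichletCharacter ℂ q₂) {φ : ℝ → ℂ} (hφ : ∀ (x : ℝ) (k : ℤ), φ (x + k) = φ x)
    {a : ℤ} (ha : IsCoprime a q₁) (n : ℤ) :
    ∑ j ∈ range (q₁ * q₂ * m), χ (j : ZMod q₂) *
        φ (n / q₁ + a * j / ((q₁ * q₂ * m : ℕ) : ℝ)) =
      ∑ j ∈ range (q₁ * q₂ * m), χ (j : ZMod q₂) * φ (a * j / ((q₁ * q₂ * m : ℕ) : ℝ)) := by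
  have : NeZero (q₁ * q₂ * m) := ⟨hc.ne'⟩
  have hc' : ((q₁ * q₂ * m : ℕ) : ℝ) ≠ 0 := by exact_mod_cast hc.ne'
  have hq₁ : (q₁ : ℝ) ≠ 0 := by intro h; apply hc'; push_cast; simp [h]
  obtain ⟨x, y, hxy⟩ := ha
  set F : ℤ → ℂ := fun j => χ (j : ZMod q₂) * φ (a * j / ((q₁ * q₂ * m : ℕ) : ℝ)) with hF
  have hper : Function.Periodic F ((q₁ * q₂ * m : ℕ) : ℤ) := by
    intro j
    have hj : (a * (j + (q₁ * q₂ * m : ℕ) : ℤ) / ((q₁ * q₂ * m : ℕ) : ℝ) : ℝ) =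
        a * j / ((q₁ * q₂ * m : ℕ) : ℝ) + a := by
      rw [Int.cast_add, Int.cast_natCast, mul_add, add_div, mul_div_cancel_right₀ _ hc']
    simp only [hF]
    rw [hj, hφ]
    simp
  have hsum := hper.sum_range_add (n * x * (q₂ * m))
  rw [hF] at hsum
  simp only [Int.cast_natCast] at hsum
  rw [← hsum]
  refine Finset.sum_congr rfl fun j _ => ?_
  have hj : (n / q₁ + a * j / ((q₁ * q₂ * m : ℕ) : ℝ) : ℝ) =
      a * (j + n * x * (q₂ * m) : ℤ) / ((q₁ * q₂ * m : ℕ) : ℝ) + (n * y : ℤ) := by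
    have hxy' : (x * a + y * q₁ : ℝ) = 1 := by exact_mod_cast hxy
    push_cast at hc' ⊢
    have hq₂ : (q₂ : ℝ) ≠ 0 := by rintro h; simp [h] at hc'
    have hm : (m : ℝ) ≠ 0 := by rintro h; simp [h] at hc'
    field_simp
    linear_combination -(n * q₂ * m : ℝ) * hxy'
  rw [hj, hφ]
  simp

theorem sum_sum_sawtooth_identities {J N : Finset ℕ} {P Q x u s : ℕ → ℂ} {t f : ℕ → ℕ → ℂ}
    {a G H : ℂ} (hP : ∑ j ∈ J, P j = 0) (hQ : ∑ n ∈ N, Q n = 0)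
    (hs : ∀ j ∈ J, P j ≠ 0 → s j = x j - 1 / 2)
    (hf : ∀ j ∈ J, ∀ n ∈ N, P j ≠ 0 → t j n = a * x j + u n - f j n - 1 / 2)
    (hG : ∀ n ∈ N, ∑ j ∈ J, P j * t j n = G) (hH : ∀ n ∈ N, ∑ j ∈ J, P j * t j n ^ 2 = H) :
    ∑ j ∈ J, ∑ n ∈ N, P j * Q n * s j * t j n =
        (∑ j ∈ J, P j * x j) * (∑ n ∈ N, Q n * u n) -
          ∑ j ∈ J, ∑ n ∈ N, P j * Q n * x j * f j n ∧
    2 * a * ∑ j ∈ J, ∑ n ∈ N, P j * Q n * s j * t j n =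
        2 * (a * (∑ j ∈ J, P j * x j) - G) * (∑ n ∈ N, Q n * u n) -
          ∑ j ∈ J, ∑ n ∈ N, P j * Q n * (f j n * (f j n - 1)) := by
  have hJ : ∀ g : ℕ → ℂ, ∑ j ∈ J, ∑ n ∈ N, g j * Q n = 0 := fun g => by
    simp [← Finset.mul_sum, hQ]
  have hN : ∀ g : ℕ → ℂ, ∑ j ∈ J, ∑ n ∈ N, g n * P j = 0 := fun g => by
    rw [Finset.sum_comm]; simp [← Finset.mul_sum, hP]
  have hB : ∑ j ∈ J, ∑ n ∈ N, (P j * x j) * (Q n * u n) =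
      (∑ j ∈ J, P j * x j) * (∑ n ∈ N, Q n * u n) := by rw [Finset.sum_mul_sum]
  have hT : ∀ g : ℕ → ℂ, ∑ j ∈ J, ∑ n ∈ N, g n * (P j * t j n) = G * ∑ n ∈ N, g n := fun g => by
    rw [Finset.sum_comm, Finset.mul_sum]
    refine Finset.sum_congr rfl fun n hn => ?_
    rw [← Finset.mul_sum, hG n hn, mul_comm]
  have hT2 : ∑ j ∈ J, ∑ n ∈ N, Q n * (P j * t j n ^ 2) = 0 := by
    rw [Finset.sum_comm]
    calc _ = ∑ n ∈ N, Q n * H := Finset.sum_congr rfl fun n hn => by rw [← Finset.mul_sum, hH n hn]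
      _ = 0 := by rw [← Finset.sum_mul, hQ, zero_mul]
  have hTQ : ∀ b : ℂ, ∑ j ∈ J, ∑ n ∈ N, (b * Q n) * (P j * t j n) = 0 := fun b => by
    rw [hT fun n => b * Q n, ← Finset.mul_sum, hQ, mul_zero, mul_zero]
  constructor
  · have key : ∀ j ∈ J, ∀ n ∈ N, P j * Q n * s j * t j n =
        (P j * (a * x j ^ 2 - x j / 2)) * Q n + (P j * x j) * (Q n * u n) -
          P j * Q n * x j * f j n - (1 / 2 * Q n) * (P j * t j n) := by
      intro j hj n hn
      by_cases h : P j = 0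
      · simp [h]
      · rw [hs j hj h, hf j hj n hn h]
        ring
    rw [Finset.sum_congr rfl fun j hj => Finset.sum_congr rfl fun n hn => key j hj n hn]
    simp only [Finset.sum_add_distrib, Finset.sum_sub_distrib]
    rw [hJ fun j => P j * (a * x j ^ 2 - x j / 2), hB, hTQ]
    ring
  · have key : ∀ j ∈ J, ∀ n ∈ N, P j * Q n * (f j n * (f j n - 1)) =
        (P j * (a ^ 2 * x j ^ 2 - 2 * a * x j + 3 / 4)) * Q n + (Q n * (u n ^ 2 - 2 * u n)) * P j +
          2 * a * ((P j * x j) * (Q n * u n)) - 2 * a * (P j * Q n * s j * t j n) -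
          2 * ((Q n * u n) * (P j * t j n)) + Q n * (P j * t j n ^ 2) +
          ((2 - a) * Q n) * (P j * t j n) := by
      intro j hj n hn
      by_cases h : P j = 0
      · simp [h]
      · rw [hs j hj h, hf j hj n hn h]
        ring
    rw [Finset.sum_congr rfl fun j hj => Finset.sum_congr rfl fun n hn => key j hj n hn]
    simp only [Finset.sum_add_distrib, Finset.sum_sub_distrib, ← Finset.mul_sum _ _ (2 * a),
      ← Finset.mul_sum _ _ (2 : ℂ)]
    rw [hJ fun j => P j * (a ^ 2 * x j ^ 2 - 2 * a * x j + 3 / 4),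
      hN fun n => Q n * (u n ^ 2 - 2 * u n), hB, hT fun n => Q n * u n, hT2, hTQ]
    ring

/-- Up to sign, multiplication by `a ≡ ±1` does not change the first moment of `χ`
against the sawtooth function. -/
theorem sum_dirichletCharacter_mul_sawtooth_mul {q c : ℕ} (hc : 0 < c) (hqc : q ∣ c)
    (χ : DirichletCharacter ℂ q) {a ε : ℤ} (hac : IsCoprime a c) (hε : ε = 1 ∨ ε = -1)
    (ha : (q : ℤ) ∣ a - ε) :
    ∑ j ∈ range c, χ (j : ZMod q) * (sawtooth (a * j / (c : ℝ)) : ℂ) =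
      ε * ∑ j ∈ range c, χ (j : ZMod q) * (sawtooth (j / (c : ℝ)) : ℂ) := by
  have : NeZero c := ⟨hc.ne'⟩
  have hc' : (c : ℝ) ≠ 0 := by exact_mod_cast hc.ne'
  have hper : Function.Periodic
      (fun j : ℤ => χ (j : ZMod q) * (sawtooth (j / (c : ℝ)) : ℂ)) (c : ℤ) := by
    intro j
    have h1 : ((j + c : ℤ) / (c : ℝ) : ℝ) = j / (c : ℝ) + (1 : ℤ) := by
      push_cast
      field_simp
    have h2 : ((j + c : ℤ) : ZMod q) = j := by
      simp [(ZMod.natCast_eq_zero_iff c q).mpr hqc]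
    beta_reduce
    rw [h1, h2, sawtooth_add_int]
  have hεε : ε * ε = 1 := by rcases hε with rfl | rfl <;> rfl
  have hcop : IsCoprime (ε * a) c := by
    rcases hε with rfl | rfl
    · simpa using hac
    · simpa using hac.neg_left
  have hχ : ((ε * a : ℤ) : ZMod q) = 1 := by
    obtain ⟨k, hk⟩ := ha
    rw [show ε * a = 1 + q * (ε * k) by linear_combination ε * hk + hεε]
    simp
  have hodd : ∀ x : ℝ, sawtooth (ε * x) = ε * sawtooth x := by
    rcases hε with rfl | rfl <;> simp [sawtooth_neg]
  have hsum := hper.sum_range_mul hcop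
  have hterm : ∀ j : ℕ, χ ((ε * a * (j : ℤ) : ℤ) : ZMod q) *
      (sawtooth ((ε * a * (j : ℤ) : ℤ) / (c : ℝ)) : ℂ) =
        ε * (χ (j : ZMod q) * (sawtooth (a * j / (c : ℝ)) : ℂ)) := by
    intro j
    have h1 : ((ε * a * (j : ℤ) : ℤ) / (c : ℝ) : ℝ) = ε * (a * j / c) := by
      push_cast
      ring
    rw [h1, hodd, Int.cast_mul, hχ]
    push_cast
    ring
  simp only [hterm, ← Finset.mul_sum, Int.cast_natCast] at hsum
  rw [← hsum, ← mul_assoc]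
  have : (ε * ε : ℂ) = 1 := by exact_mod_cast hεε
  rw [this, one_mul]

theorem newformDedekindSum_mem_subring {q₁ q₂ m : ℕ} (hm : 0 < m) (hq₁ : 0 < q₁) (hq₂ : 0 < q₂)
    {χ₁ : DirichletCharacter ℂ q₁} {χ₂ : DirichletCharacter ℂ q₂} (hχ₁ : χ₁ ≠ 1) (hχ₂ : χ₂ ≠ 1)
    {R : Subring ℂ} (hR₁ : ∀ x, χ₁ x ∈ R) (hR₂ : ∀ x, χ₂ x ∈ R) {a ε : ℤ}
    (hac : IsCoprime a (q₁ * q₂ * m : ℕ)) (hε : ε = 1 ∨ ε = -1)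
    (ha : ((q₁ * q₂ : ℕ) : ℤ) ∣ a - ε) :
    ∑ j ∈ range (q₁ * q₂ * m), ∑ n ∈ range q₁, χ₂ (j : ZMod q₂) * χ₁ (n : ZMod q₁) *
      (sawtooth (j / ((q₁ * q₂ * m : ℕ) : ℝ)) : ℂ) *
      (sawtooth (n / q₁ + a * j / ((q₁ * q₂ * m : ℕ) : ℝ)) : ℂ) ∈ R := by
  set c := q₁ * q₂ * m with hcdef
  have hc : 0 < c := by positivity
  have hcR : (c : ℝ) ≠ 0 := by exact_mod_cast hc.ne'
  have hq₁R : (q₁ : ℝ) ≠ 0 := by exact_mod_cast hq₁.ne'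
  have hcC : (c : ℂ) ≠ 0 := by exact_mod_cast hc.ne'
  have hq₁C : (q₁ : ℂ) ≠ 0 := by exact_mod_cast hq₁.ne'
  have hq₂C : (q₂ : ℂ) ≠ 0 := by exact_mod_cast hq₂.ne'
  have hcast : (c : ℂ) = q₁ * q₂ * m := by simp [hcdef]
  have hqc : q₂ ∣ c := ⟨q₁ * m, by rw [hcdef]; ring⟩
  have hcop₁ : IsCoprime a (q₁ : ℤ) := by
    refine hac.of_isCoprime_of_dvd_right ⟨(q₂ * m : ℕ), ?_⟩
    rw [hcdef]; push_cast; ring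
  have hcop₂ : IsCoprime a (q₂ : ℤ) := by
    refine hac.of_isCoprime_of_dvd_right ⟨(q₁ * m : ℕ), ?_⟩
    rw [hcdef]; push_cast; ring
  have ha₂ : (q₂ : ℤ) ∣ a - ε := (Dvd.intro_left (q₁ : ℤ) (Nat.cast_mul q₁ q₂).symm).trans ha
  -- no sawtooth is evaluated at an integer where `χ₂` does not vanish
  have hint : ∀ (b n : ℤ) (j : ℕ), IsCoprime b (q₂ : ℤ) → χ₂ (j : ZMod q₂) ≠ 0 →
      ∀ k : ℤ, (k : ℝ) ≠ n / q₁ + b * j / (c : ℝ) := by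
    intro b n j hb hj k hk
    have hkc : k * c = n * (q₂ * m : ℕ) + b * j := by
      have : (k : ℝ) * c = n * (q₂ * m) + b * j := by
        rw [hk, hcdef]
        push_cast
        have hq₂R : (q₂ : ℝ) ≠ 0 := by exact_mod_cast hq₂.ne'
        have hmR : (m : ℝ) ≠ 0 := by exact_mod_cast hm.ne'
        field_simp
      exact_mod_cast this
    have hdvd : (q₂ : ℤ) ∣ b * j :=
      ⟨k * (q₁ * m) - n * m, by rw [hcdef] at hkc; push_cast at hkc; linear_combination -hkc⟩
    have hzero : (j : ZMod q₂) = 0 :=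
      (ZMod.natCast_eq_zero_iff j q₂).mpr (Int.natCast_dvd_natCast.mp
        (hb.symm.dvd_of_dvd_mul_left hdvd))
    have hunit : IsUnit (j : ZMod q₂) := by
      by_contra h
      exact hj (χ₂.map_nonunit h)
    rw [hzero] at hunit
    have h1 : q₂ = 1 := by
      have : Subsingleton (ZMod q₂) := isUnit_zero_iff.mp hunit |> subsingleton_of_zero_eq_one
      simpa using (ZMod.subsingleton_iff.mp this)
    subst h1
    exact hχ₂ (Subsingleton.elim _ _)
  obtain ⟨hP, hPx⟩ := sum_range_mul_dirichletCharacter hq₂ hχ₂ (q₁ * m)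
  rw [show q₂ * (q₁ * m) = c by rw [hcdef]; ring] at hP hPx
  have hs : ∀ j ∈ range c, χ₂ (j : ZMod q₂) ≠ 0 →
      (sawtooth (j / (c : ℝ)) : ℂ) = (j / c : ℂ) - 1 / 2 := by
    intro j hj hne
    have h := hint 1 0 j isCoprime_one_left hne
    simp only [Int.cast_zero, zero_div, zero_add, Int.cast_one, one_mul] at h
    have hfl : ⌊(j / c : ℝ)⌋ = 0 := by
      rw [Int.floor_eq_zero_iff]
      exact ⟨by positivity, (div_lt_one (by positivity)).mpr (by exact_mod_cast mem_range.mp hj)⟩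
    rw [sawtooth_of_ne_int h, hfl]
    push_cast
    ring
  have hf : ∀ j ∈ range c, ∀ n ∈ range q₁, χ₂ (j : ZMod q₂) ≠ 0 →
      (sawtooth (n / q₁ + a * j / (c : ℝ)) : ℂ) =
        a * (j / c : ℂ) + (n / q₁ : ℂ) - (⌊(n / q₁ + a * j / c : ℝ)⌋ : ℂ) - 1 / 2 := by
    intro j _ n _ hne
    have h := hint a n j hcop₂ hne
    rw [Int.cast_natCast] at h
    rw [sawtooth_of_ne_int h]
    push_cast
    ring
  have hG := fun n (_ : n ∈ range q₁) => sum_dirichletCharacter_mul_periodic (m := m) hc χ₂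
    (φ := fun x => (sawtooth x : ℂ)) (fun x k => by rw [sawtooth_add_int]) hcop₁ (n : ℕ)
  have hH := fun n (_ : n ∈ range q₁) => sum_dirichletCharacter_mul_periodic (m := m) hc χ₂
    (φ := fun x => (sawtooth x : ℂ) ^ 2) (fun x k => by rw [sawtooth_add_int]) hcop₁ (n : ℕ)
  simp only [Int.cast_natCast, ← hcdef] at hG hH
  obtain ⟨h1, h2⟩ := sum_sum_sawtooth_identities (J := range c) (N := range q₁)
    hP (sum_range_dirichletCharacter_eq_zero hq₁ hχ₁) hs hf hG hH
  rw [sum_dirichletCharacter_mul_sawtooth_mul hc hqc χ₂ hac hε ha₂] at h2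
  have hs' : ∑ j ∈ range c, χ₂ (j : ZMod q₂) * (sawtooth (j / (c : ℝ)) : ℂ) =
      ∑ j ∈ range c, χ₂ (j : ZMod q₂) * (j / c : ℂ) := by
    have : ∀ j ∈ range c, χ₂ (j : ZMod q₂) * (sawtooth (j / (c : ℝ)) : ℂ) =
        χ₂ (j : ZMod q₂) * (j / c : ℂ) - χ₂ (j : ZMod q₂) * (1 / 2) := by
      intro j hj
      by_cases h : χ₂ (j : ZMod q₂) = 0
      · simp [h]
      · rw [hs j hj h]
        ring
    rw [Finset.sum_congr rfl this, Finset.sum_sub_distrib, ← Finset.sum_mul, hP, zero_mul, sub_zero]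
  rw [hs'] at h2
  set S := ∑ j ∈ range c, ∑ n ∈ range q₁, χ₂ (j : ZMod q₂) * χ₁ (n : ZMod q₁) *
    (sawtooth (j / (c : ℝ)) : ℂ) * (sawtooth (n / q₁ + a * j / (c : ℝ)) : ℂ) with hS
  have hB₂ : q₂ * ∑ j ∈ range c, χ₂ (j : ZMod q₂) * (j / c : ℂ) =
      ∑ n ∈ range q₂, χ₂ (n : ZMod q₂) * n := by
    have hmC : (m : ℂ) ≠ 0 := by exact_mod_cast hm.ne'
    simp only [← mul_div_assoc, ← Finset.sum_div, hPx, hcast]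
    push_cast
    field_simp
  have hB₁ : q₁ * ∑ n ∈ range q₁, χ₁ (n : ZMod q₁) * (n / q₁ : ℂ) =
      ∑ n ∈ range q₁, χ₁ (n : ZMod q₁) * n := by
    simp only [← mul_div_assoc, ← Finset.sum_div]
    field_simp
  set B₁ := ∑ n ∈ range q₁, χ₁ (n : ZMod q₁) * (n / q₁ : ℂ)
  set B₂ := ∑ j ∈ range c, χ₂ (j : ZMod q₂) * (j / c : ℂ)
  have hB : q₁ * q₂ * (B₂ * B₁) ∈ R := by
    rw [show q₁ * q₂ * (B₂ * B₁) = (q₂ * B₂) * (q₁ * B₁) by ring, hB₁, hB₂]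
    exact R.mul_mem (R.sum_mem fun n _ => R.mul_mem (hR₂ _) (natCast_mem R n))
      (R.sum_mem fun n _ => R.mul_mem (hR₁ _) (natCast_mem R n))
  have hcS : c * S ∈ R := by
    have : c * S = m * (q₁ * q₂ * (B₂ * B₁)) - ∑ j ∈ range c, ∑ n ∈ range q₁,
        χ₂ (j : ZMod q₂) * χ₁ (n : ZMod q₁) * j * (⌊(n / q₁ + a * j / c : ℝ)⌋ : ℂ) := by
      rw [h1, mul_sub, Finset.mul_sum (range c)]
      congr 1
      · rw [hcast]; ring
      · refine Finset.sum_congr rfl fun j _ => ?_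
        rw [Finset.mul_sum]
        refine Finset.sum_congr rfl fun n _ => ?_
        field_simp
    rw [this]
    exact R.sub_mem (R.mul_mem (natCast_mem R m) hB) (R.sum_mem fun j _ => R.sum_mem fun n _ =>
      R.mul_mem (R.mul_mem (R.mul_mem (hR₂ _) (hR₁ _)) (natCast_mem R j)) (intCast_mem R _))
  have haS : a * S ∈ R := by
    obtain ⟨k, hk⟩ := ha
    have hkC : (a - ε : ℂ) = q₁ * q₂ * k := by exact_mod_cast congrArg (Int.cast : ℤ → ℂ) hk
    choose g hg using fun z : ℤ => (Int.even_mul_pred_self z).two_dvd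
    have hgC : ∀ z : ℤ, (z * (z - 1) : ℂ) = 2 * g z := fun z => by
      exact_mod_cast congrArg (Int.cast : ℤ → ℂ) (hg z)
    have : a * S = k * (q₁ * q₂ * (B₂ * B₁)) - ∑ j ∈ range c, ∑ n ∈ range q₁,
        χ₂ (j : ZMod q₂) * χ₁ (n : ZMod q₁) * (g ⌊(n / q₁ + a * j / c : ℝ)⌋ : ℂ) := by
      simp only [hgC, mul_left_comm _ (2 : ℂ), ← Finset.mul_sum] at h2
      linear_combination h2 / 2 + B₂ * B₁ * hkC
    rw [this]
    exact R.sub_mem (R.mul_mem (intCast_mem R k) hB) (R.sum_mem fun j _ => R.sum_mem fun n _ =>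
      R.mul_mem (R.mul_mem (hR₂ _) (hR₁ _)) (intCast_mem R _))
  obtain ⟨x, y, hxy⟩ := hac
  have hxyC : (x * a + y * c : ℂ) = 1 := by exact_mod_cast congrArg (Int.cast : ℤ → ℂ) hxy
  rw [show S = x * (a * S) + y * (c * S) by linear_combination -S * hxyC]
  exact R.add_mem (R.mul_mem (intCast_mem R x) haS) (R.mul_mem (intCast_mem R y) hcS)

/-- `InRingOfIntegers`, as a subring of `ℂ`. -/
noncomputable def characterIntegers {q₁ q₂ : ℕ} (χ₁ : DirichletCharacter ℂ q₁)
    (χ₂ : DirichletCharacter ℂ q₂) : Subring ℂ :=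
  (Subfield.closure
    (Set.range (χ₁ : ZMod q₁ → ℂ) ∪ Set.range (χ₂ : ZMod q₂ → ℂ))).toSubring ⊓
    (integralClosure ℤ ℂ).toSubring

theorem isIntegral_dirichletCharacter {q : ℕ} (hq : 0 < q) (χ : DirichletCharacter ℂ q)
    (x : ZMod q) : IsIntegral ℤ (χ x) := by
  have : NeZero q := ⟨hq.ne'⟩
  by_cases hx : IsUnit x
  · obtain ⟨u, rfl⟩ := hx
    refine IsIntegral.of_pow (n := Fintype.card (ZMod q)ˣ) Fintype.card_pos ?_
    rw [← map_pow, ← Units.val_pow_eq_pow_val, pow_card_eq_one, Units.val_one, map_one]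
    exact isIntegral_one
  · rw [χ.map_nonunit hx]
    exact isIntegral_zero

theorem newformDedekindSum_inRingOfIntegers {q₁ q₂ : ℕ} (hq₁ : 0 < q₁) (hq₂ : 0 < q₂)
    (χ₁ : DirichletCharacter ℂ q₁) (χ₂ : DirichletCharacter ℂ q₂) (hχ₁ : χ₁ ≠ 1) (hχ₂ : χ₂ ≠ 1)
    {a c ε : ℤ} (hc : 1 ≤ c) (hqc : ((q₁ * q₂ : ℕ) : ℤ) ∣ c) (hac : IsCoprime a c)
    (hε : ε = 1 ∨ ε = -1) (ha : ((q₁ * q₂ : ℕ) : ℤ) ∣ a - ε) :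
    InRingOfIntegers χ₁ χ₂ (newformDedekindSum χ₁ χ₂ a c) := by
  lift c to ℕ using by lia
  obtain ⟨m, rfl⟩ := Int.natCast_dvd_natCast.mp hqc
  have hm : 0 < m := by
    rcases Nat.eq_zero_or_pos m with rfl | h
    · simp at hc
    · exact h
  have hR₁ : ∀ x, χ₁⁻¹ x ∈ characterIntegers χ₁ χ₂ := fun x =>
    ⟨MulChar.inv_apply χ₁ x ▸ Subfield.subset_closure (Or.inl ⟨_, rfl⟩),
      isIntegral_dirichletCharacter hq₁ _ x⟩
  have hR₂ : ∀ x, χ₂⁻¹ x ∈ characterIntegers χ₁ χ₂ := fun x =>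
    ⟨MulChar.inv_apply χ₂ x ▸ Subfield.subset_closure (Or.inr ⟨_, rfl⟩),
      isIntegral_dirichletCharacter hq₂ _ x⟩
  have h := newformDedekindSum_mem_subring hm hq₁ hq₂ (inv_ne_one.mpr hχ₁) (inv_ne_one.mpr hχ₂)
    hR₁ hR₂ hac hε ha
  simp only [← MulChar.star_apply', ← starRingEnd_apply] at h
  have hS : newformDedekindSum χ₁ χ₂ a ((q₁ * q₂ * m : ℕ) : ℤ) ∈ characterIntegers χ₁ χ₂ := by
    simpa only [newformDedekindSum, Int.toNat_natCast, Int.cast_natCast] using h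
  exact hS

theorem newform_dedekind_sum_gamma1_integral_of_coprime {q₁ q₂ : ℕ} (hq₁ : 0 < q₁) (hq₂ : 0 < q₂)
    (χ₁ : DirichletCharacter ℂ q₁) (χ₂ : DirichletCharacter ℂ q₂)
    (hχ₁ : χ₁ ≠ 1) (hχ₂ : χ₂ ≠ 1) (hp₁ : χ₁.IsPrimitive) (hp₂ : χ₂.IsPrimitive)
    (hpar : χ₁ (-1) * χ₂ (-1) = 1)
    (hgcd : Nat.gcd q₁ q₂ = 1) :
    ∀ γ : Matrix.SpecialLinearGroup (Fin 2) ℤ, InGamma1 (q₁ * q₂) γ →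
      InRingOfIntegers χ₁ χ₂ (newformDedekindSumSL χ₁ χ₂ γ) := by
  intro γ ⟨hc, ha, _⟩
  have hdet := γ.2
  rw [Matrix.det_fin_two] at hdet
  have hac : IsCoprime (γ.1 0 0) (γ.1 1 0) :=
    ⟨γ.1 1 1, -γ.1 0 1, by linear_combination hdet⟩
  unfold newformDedekindSumSL
  split_ifs with h0 h1
  · exact (characterIntegers χ₁ χ₂).zero_mem
  · exact newformDedekindSum_inRingOfIntegers hq₁ hq₂ χ₁ χ₂ hχ₁ hχ₂ h1 hc hac (Or.inl rfl) ha
  · refine newformDedekindSum_inRingOfIntegers hq₁ hq₂ χ₁ χ₂ hχ₁ hχ₂ (by lia) hc.neg_right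
      hac.neg_neg (Or.inr rfl) ?_
    rw [show -γ.1 0 0 - -1 = -(γ.1 0 0 - 1) by ring]
    exact ha.neg_right
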